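/- Characterization of the eigenvalues of the clamped biharmonic operator: a real number λ > 0 is an eigenvalue of the clamped biharmonic operator on [0,1] if and only if λ = β⁴ for some β > 0 satisfying cos β · cosh β = 1. -/

import Mathlib

open Real Set

/-- `lam` is an eigenvalue of the clamped biharmonic operator on `[0,1]`: there is a
nonzero four times continuously differentiable `φ` with `φ⁗ = lam·φ` on `[0,1]` and
`φ(0) = φ'(0) = φ(1) = φ'(1) = 0`. -/
def IsClampedBiharmonicEV (lam : ℝ) : Prop :=
  ∃ φ : ℝ → ℝ, ContDiff ℝ 4 φ ∧ (∃ x ∈ Set.Icc (0:ℝ) 1, φ x ≠ 0) ∧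
    (∀ x ∈ Set.Icc (0:ℝ) 1, iteratedDeriv 4 φ x = lam * φ x) ∧
    φ 0 = 0 ∧ deriv φ 0 = 0 ∧ φ 1 = 0 ∧ deriv φ 1 = 0

/-- A function with zero derivative on `[0, 1]` is constant there. -/
lemma eq_of_hasDerivAt_zero_on_Icc {F : ℝ → ℝ}
    (hF : ∀ x ∈ Icc (0 : ℝ) 1, HasDerivAt F 0 x) {x : ℝ} (hx : x ∈ Icc (0 : ℝ) 1) :
    F x = F 0 :=
  constant_of_has_deriv_right_zero (fun y hy => (hF y hy).continuousAt.continuousWithinAt)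
    (fun y hy => (hF y (Ico_subset_Icc_self hy)).hasDerivWithinAt) x hx

/-- The four first integrals of `φ⁗ = β⁴ φ` on `[0, 1]` for clamped data at `0`, with the equation
written as a first-order system. -/
lemma biharmonic_first_integrals {β : ℝ} {f₀ f₁ f₂ f₃ : ℝ → ℝ}
    (h₀ : ∀ x, HasDerivAt f₀ (f₁ x) x) (h₁ : ∀ x, HasDerivAt f₁ (f₂ x) x)
    (h₂ : ∀ x, HasDerivAt f₂ (f₃ x) x)
    (h₃ : ∀ x ∈ Icc (0 : ℝ) 1, HasDerivAt f₃ (β ^ 4 * f₀ x) x)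
    (z₀ : f₀ 0 = 0) (z₁ : f₁ 0 = 0) {x : ℝ} (hx : x ∈ Icc (0 : ℝ) 1) :
    (cosh (β * x) - sinh (β * x)) * (f₃ x + β * f₂ x + β ^ 2 * f₁ x + β ^ 3 * f₀ x)
        = f₃ 0 + β * f₂ 0 ∧
      (cosh (β * x) + sinh (β * x)) * (f₃ x - β * f₂ x + β ^ 2 * f₁ x - β ^ 3 * f₀ x)
        = f₃ 0 - β * f₂ 0 ∧
      cos (β * x) * (f₃ x - β ^ 2 * f₁ x) + β * sin (β * x) * (f₂ x - β ^ 2 * f₀ x) = f₃ 0 ∧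
      sin (β * x) * (f₃ x - β ^ 2 * f₁ x) - β * cos (β * x) * (f₂ x - β ^ 2 * f₀ x)
        = -(β * f₂ 0) := by
  have hl (y : ℝ) : HasDerivAt (fun y => β * y) β y := by
    simpa using (hasDerivAt_id y).const_mul β
  refine ⟨?_, ?_, ?_, ?_⟩
  · have := eq_of_hasDerivAt_zero_on_Icc (F := fun x => (cosh (β * x) - sinh (β * x)) *
      (f₃ x + β * f₂ x + β ^ 2 * f₁ x + β ^ 3 * f₀ x)) (fun y hy => by
        refine (((hl y).cosh.sub (hl y).sinh).mul ((((h₃ y hy).add ((h₂ y).const_mul β)).add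
          ((h₁ y).const_mul (β ^ 2))).add ((h₀ y).const_mul (β ^ 3)))).congr_deriv ?_
        simp only [Pi.add_apply, Pi.sub_apply]
        ring) hx
    simpa [z₀, z₁] using this
  · have := eq_of_hasDerivAt_zero_on_Icc (F := fun x => (cosh (β * x) + sinh (β * x)) *
      (f₃ x - β * f₂ x + β ^ 2 * f₁ x - β ^ 3 * f₀ x)) (fun y hy => by
        refine (((hl y).cosh.add (hl y).sinh).mul ((((h₃ y hy).sub ((h₂ y).const_mul β)).add
          ((h₁ y).const_mul (β ^ 2))).sub ((h₀ y).const_mul (β ^ 3)))).congr_deriv ?_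
        simp only [Pi.add_apply, Pi.sub_apply]
        ring) hx
    simpa [z₀, z₁] using this
  · have := eq_of_hasDerivAt_zero_on_Icc (F := fun x => cos (β * x) * (f₃ x - β ^ 2 * f₁ x) +
      β * sin (β * x) * (f₂ x - β ^ 2 * f₀ x)) (fun y hy => by
        refine (((hl y).cos.mul ((h₃ y hy).sub ((h₁ y).const_mul (β ^ 2)))).add
          (((hl y).sin.const_mul β).mul
            ((h₂ y).sub ((h₀ y).const_mul (β ^ 2))))).congr_deriv ?_
        simp only [Pi.sub_apply]
        ring) hx
    simpa [z₀, z₁] using this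
  · have := eq_of_hasDerivAt_zero_on_Icc (F := fun x => sin (β * x) * (f₃ x - β ^ 2 * f₁ x) -
      β * cos (β * x) * (f₂ x - β ^ 2 * f₀ x)) (fun y hy => by
        refine (((hl y).sin.mul ((h₃ y hy).sub ((h₁ y).const_mul (β ^ 2)))).sub
          (((hl y).cos.const_mul β).mul
            ((h₂ y).sub ((h₀ y).const_mul (β ^ 2))))).congr_deriv ?_
        simp only [Pi.sub_apply]
        ring) hx
    simpa [z₀, z₁] using this

/-- A clamped solution of `φ⁗ = β⁴ φ` vanishes on `[0, 1]` unless `cos β * cosh β = 1`. -/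
lemma eq_zero_of_clamped_biharmonic {β : ℝ} (hβ : 0 < β) (hne : cos β * cosh β ≠ 1)
    {f₀ f₁ f₂ f₃ : ℝ → ℝ}
    (h₀ : ∀ x, HasDerivAt f₀ (f₁ x) x) (h₁ : ∀ x, HasDerivAt f₁ (f₂ x) x)
    (h₂ : ∀ x, HasDerivAt f₂ (f₃ x) x)
    (h₃ : ∀ x ∈ Icc (0 : ℝ) 1, HasDerivAt f₃ (β ^ 4 * f₀ x) x)
    (z₀ : f₀ 0 = 0) (z₁ : f₁ 0 = 0) (o₀ : f₀ 1 = 0) (o₁ : f₁ 1 = 0)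
    {x : ℝ} (hx : x ∈ Icc (0 : ℝ) 1) : f₀ x = 0 := by
  have key {y : ℝ} (hy : y ∈ Icc (0 : ℝ) 1) :=
    biharmonic_first_integrals h₀ h₁ h₂ h₃ z₀ z₁ hy
  obtain ⟨e₁, e₂, e₃, e₄⟩ := key (right_mem_Icc.2 zero_le_one)
  simp only [mul_one, o₀, o₁, mul_zero, add_zero, sub_zero] at e₁ e₂ e₃ e₄
  have hch := cosh_sq β
  have hcs := sin_sq_add_cos_sq β
  have hdet : 2 - 2 * (cos β * cosh β) ≠ 0 := fun h => hne (by linarith)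
  generalize f₃ 0 = b at *
  generalize ha : f₂ 0 = a at *
  generalize f₃ 1 = d at *
  generalize f₂ 1 = c at *
  have d₁ : d = cosh β * b + sinh β * (β * a) := by
    linear_combination (cosh β + sinh β) / 2 * e₁ + (cosh β - sinh β) / 2 * e₂ - d * hch
  have c₁ : β * c = sinh β * b + cosh β * (β * a) := by
    linear_combination (cosh β + sinh β) / 2 * e₁ - (cosh β - sinh β) / 2 * e₂ - β * c * hch
  have d₂ : d = cos β * b - sin β * (β * a) := by
    linear_combination cos β * e₃ + sin β * e₄ - d * hcs
  have c₂ : β * c = sin β * b + cos β * (β * a) := by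
    linear_combination sin β * e₃ - cos β * e₄ - β * c * hcs
  have r₁ : (cosh β - cos β) * b + (sinh β + sin β) * (β * a) = 0 := by linarith
  have r₂ : (sinh β - sin β) * b + (cosh β - cos β) * (β * a) = 0 := by linarith
  have hb : b = 0 := by
    refine (mul_eq_zero.1 (?_ : (2 - 2 * (cos β * cosh β)) * b = 0)).resolve_left hdet
    linear_combination (cosh β - cos β) * r₁ - (sinh β + sin β) * r₂ - b * hch - b * hcs
  have ha' : β * a = 0 := by
    refine (mul_eq_zero.1 (?_ : (2 - 2 * (cos β * cosh β)) * (β * a) = 0)).resolve_left hdet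
    linear_combination (cosh β - cos β) * r₂ - (sinh β - sin β) * r₁ - β * a * hch - β * a * hcs
  obtain ⟨k₁, k₂, k₃, k₄⟩ := key hx
  have hch := cosh_sq (β * x)
  have hcs := sin_sq_add_cos_sq (β * x)
  rw [hb, ha'] at k₁ k₂
  rw [hb] at k₃
  rw [ha'] at k₄
  have h : 4 * β ^ 3 * f₀ x = 0 := by
    linear_combination (cosh (β * x) + sinh (β * x)) * k₁
      - (cosh (β * x) - sinh (β * x)) * k₂
      - 2 * (sin (β * x) * k₃ - cos (β * x) * k₄)
      - (2 * β * f₂ x + 2 * β ^ 3 * f₀ x) * hch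
      + 2 * β * (f₂ x - β ^ 2 * f₀ x) * hcs
  simpa [hβ.ne'] using h

/-- The combination `A cosh + B sinh + C cos + D sin` at frequency `β` and its derivative. -/
lemma hasDerivAt_cosh_sinh_cos_sin (β A B C D x : ℝ) :
    HasDerivAt
      (fun x => A * cosh (β * x) + B * sinh (β * x) + C * cos (β * x) + D * sin (β * x))
      (β * B * cosh (β * x) + β * A * sinh (β * x) + β * D * cos (β * x)
        + -(β * C) * sin (β * x)) x := by
  have hl : HasDerivAt (fun y => β * y) β x := by
    simpa using (hasDerivAt_id x).const_mul β
  refine ((((hl.cosh.const_mul A).add (hl.sinh.const_mul B)).add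
    (hl.cos.const_mul C)).add (hl.sin.const_mul D)).congr_deriv ?_
  ring

lemma eq_zero_of_hasDerivAt_of_eq_zero_on_Ioo {f f' : ℝ → ℝ}
    (hf : ∀ x, HasDerivAt f (f' x) x) (h : ∀ x ∈ Ioo (0 : ℝ) 1, f x = 0) :
    ∀ x ∈ Ioo (0 : ℝ) 1, f' x = 0 := fun x hx =>
  (hf x).unique <| (hasDerivAt_const x (0 : ℝ)).congr_of_eventuallyEq <|
    Filter.eventually_of_mem (isOpen_Ioo.mem_nhds hx) h

lemma hasDerivAt_iteratedDeriv {f : ℝ → ℝ} {n : WithTop ℕ∞} (hf : ContDiff ℝ n f) {k : ℕ}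
    (hk : (k : WithTop ℕ∞) < n) (x : ℝ) :
    HasDerivAt (iteratedDeriv k f) (iteratedDeriv (k + 1) f x) x := by
  rw [iteratedDeriv_succ]
  exact (hf.differentiable_iteratedDeriv k hk x).hasDerivAt

/-- Every positive root `β` of `cos β * cosh β = 1` gives the eigenvalue `β ^ 4`. -/
lemma isClampedBiharmonicEV_pow_four {β : ℝ} (hβ : 0 < β) (h : cos β * cosh β = 1) :
    IsClampedBiharmonicEV (β ^ 4) := by
  set A : ℝ := -(cosh β - cos β) with hA
  set B : ℝ := sinh β + sin β with hB
  have hB0 : 0 < B := by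
    have h₁ := self_lt_sinh_iff.2 hβ
    have h₂ : -β < sin β :=
      (abs_lt.1 ((abs_sin_lt_abs hβ.ne').trans_eq (abs_of_pos hβ))).1
    linarith
  have hd := hasDerivAt_cosh_sinh_cos_sin β
  set φ : ℝ → ℝ := fun x =>
    A * cosh (β * x) + B * sinh (β * x) + -A * cos (β * x) + -B * sin (β * x) with hφ
  have d₁ := hd A B (-A) (-B)
  have d₂ := hd (β * B) (β * A) (β * -B) (-(β * -A))
  have d₃ := hd (β * (β * A)) (β * (β * B)) (β * -(β * -A)) (-(β * (β * -B)))
  have d₄ := hd (β * (β * (β * B))) (β * (β * (β * A))) (β * -(β * (β * -B)))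
    (-(β * (β * -(β * -A))))
  have hch := cosh_sq β
  have hcs := sin_sq_add_cos_sq β
  refine ⟨φ, by simp only [hφ]; fun_prop, ?_, fun x _ => ?_, by simp [hφ], ?_, ?_, ?_⟩
  · by_contra! hz
    have z₀ : ∀ x ∈ Ioo (0 : ℝ) 1, φ x = 0 := fun x hx => hz x (Ioo_subset_Icc_self hx)
    have z₁ := eq_zero_of_hasDerivAt_of_eq_zero_on_Ioo d₁ z₀
    have z₂ := eq_zero_of_hasDerivAt_of_eq_zero_on_Ioo d₂ z₁
    have z₃ := eq_zero_of_hasDerivAt_of_eq_zero_on_Ioo d₃ z₂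
    have hm : (1 / 2 : ℝ) ∈ Ioo (0 : ℝ) 1 := by norm_num
    have hm₀ := z₀ _ hm
    have hm₁ := z₁ _ hm
    have hm₂ := z₂ _ hm
    have hm₃ := z₃ _ hm
    simp only [hφ] at hm₀
    have hc := cosh_sq (β * (1 / 2))
    have : 2 * β ^ 3 * B = 0 := by
      linear_combination cosh (β * (1 / 2)) * (hm₃ + β ^ 2 * hm₁)
        - sinh (β * (1 / 2)) * (β * hm₂ + β ^ 3 * hm₀) - 2 * β ^ 3 * B * hc
    have : 0 < 2 * β ^ 3 * B := by positivity
    linarith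
  · simp only [iteratedDeriv_succ, iteratedDeriv_zero]
    rw [_root_.deriv_eq d₁, _root_.deriv_eq d₂, _root_.deriv_eq d₃, _root_.deriv_eq d₄]
    simp only [hφ]
    ring
  · rw [(d₁ 0).deriv]
    simp
  · simp only [hφ, mul_one]
    linear_combination 2 * h - hch - hcs
  · rw [(d₁ 1).deriv]
    simp only [mul_one]
    ring

/-- Characterization of the eigenvalues of the clamped biharmonic operator: `λ > 0` is an
eigenvalue iff `λ = β⁴` for some `β > 0` with `cos β · cosh β = 1`. -/
theorem clamped_biharmonic_eigenvalue_characterization (lam : ℝ) (hlam : 0 < lam) :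
    IsClampedBiharmonicEV lam ↔
      ∃ β : ℝ, 0 < β ∧ Real.cos β * Real.cosh β = 1 ∧ lam = β ^ 4 := by
  constructor
  · rintro ⟨φ, hφ, ⟨x, hx, hne⟩, hode, z₀, z₁, o₀, o₁⟩
    obtain ⟨β, hβ, rfl⟩ : ∃ β : ℝ, 0 < β ∧ lam = β ^ 4 :=
      ⟨lam ^ (1 / 4 : ℝ), by positivity, by
        rw [← Real.rpow_natCast, ← Real.rpow_mul hlam.le]; norm_num⟩
    refine ⟨β, hβ, ?_, rfl⟩
    by_contra hcc
    have h₀ := hasDerivAt_iteratedDeriv hφ (k := 0) (by norm_num)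
    have h₁ := hasDerivAt_iteratedDeriv hφ (k := 1) (by norm_num)
    have h₂ := hasDerivAt_iteratedDeriv hφ (k := 2) (by norm_num)
    have h₃ := hasDerivAt_iteratedDeriv hφ (k := 3) (by norm_num)
    rw [iteratedDeriv_zero, zero_add, iteratedDeriv_one] at h₀
    rw [iteratedDeriv_one] at h₁
    exact hne (eq_zero_of_clamped_biharmonic hβ hcc h₀ h₁ h₂
      (fun y hy => (h₃ y).congr_deriv (hode y hy)) z₀ z₁ o₀ o₁ hx)
  · rintro ⟨β, hβ, h, rfl⟩
    exact isClampedBiharmonicEV_pow_four hβ h
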